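/- There exists a constant c > 0 such that for every positive integer N there is a doubly indexed sequence of complex numbers (a_{n,m})_{n,m=-N}^{N}, not all zero, with ‖∑_{n,m=-N}^{N} a_{n,m} e(n x + m y − (n² + m²) x³)‖_{L²([-1,1]²)} ≥ c N^{1/12} (∑_{n,m=-N}^{N} |a_{n,m}|²)^{1/2}. -/

import Mathlib

open MeasureTheory

/-- `e z = e^{2πiz}`. -/
noncomputable def e (t : ℝ) : ℂ := Complex.exp (2 * Real.pi * Complex.I * t)

/-- The closed square `[-1,1]²`. -/
def Sq : Set (ℝ × ℝ) := Set.Icc (-1) 1 ×ˢ Set.Icc (-1) 1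

lemma e_add (s t : ℝ) : e (s + t) = e s * e t := by
  rw [e, e, e, ← Complex.exp_add]
  push_cast
  ring_nf

lemma e_eq_exp_ofReal_mul_I (t : ℝ) : e t = Complex.exp ((2 * Real.pi * t : ℝ) * Complex.I) := by
  rw [e]
  push_cast
  ring_nf

lemma norm_e (t : ℝ) : ‖e t‖ = 1 := by
  rw [e_eq_exp_ofReal_mul_I, Complex.norm_exp_ofReal_mul_I]

lemma re_e (t : ℝ) : (e t).re = Real.cos (2 * Real.pi * t) := by
  rw [e_eq_exp_ofReal_mul_I, Complex.exp_ofReal_mul_I_re]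

lemma half_le_re_e {t : ℝ} (ht : |t| ≤ 1 / 10) : 1 / 2 ≤ (e t).re := by
  rw [re_e]
  refine le_trans ?_ (Real.one_sub_sq_div_two_le_cos)
  have h1 : t ^ 2 ≤ (1 / 10) ^ 2 := sq_le_sq' (abs_le.1 ht).1 (abs_le.1 ht).2
  have h2 : Real.pi ^ 2 ≤ 4 ^ 2 := pow_le_pow_left₀ Real.pi_pos.le Real.pi_le_four 2
  have h3 : Real.pi ^ 2 * t ^ 2 ≤ 4 ^ 2 * (1 / 10) ^ 2 := by gcongr
  nlinarith

/-- Unimodular numbers whose phases are all close to a common phase add up without cancellation. -/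
lemma card_div_two_le_norm_sum_e {ι : Type*} (J : Finset ι) (θ : ι → ℝ) (φ : ℝ)
    (h : ∀ n ∈ J, |θ n - φ| ≤ 1 / 10) : (J.card : ℝ) / 2 ≤ ‖∑ n ∈ J, e (θ n)‖ := by
  have h1 : ∑ n ∈ J, e (θ n) = e φ * ∑ n ∈ J, e (θ n - φ) := by
    rw [Finset.mul_sum]
    refine Finset.sum_congr rfl fun n _ => ?_
    rw [← e_add]
    ring_nf
  rw [h1, norm_mul, norm_e, one_mul]
  refine le_trans ?_ (Complex.re_le_norm _)
  rw [Complex.re_sum]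
  calc (J.card : ℝ) / 2 = ∑ _n ∈ J, (1 / 2 : ℝ) := by
        rw [Finset.sum_const, nsmul_eq_mul]; ring
    _ ≤ _ := Finset.sum_le_sum fun n hn => half_le_re_e (h n hn)

/-- With `x₀ = (6N)^{-1/2}` and `N = u⁶`, the increment over `[x₀, x₀ + t]` of the phase
`n x - n² x³` is almost the same for all `n = N - k` with `0 ≤ k ≤ u⁵`, as long as
`0 ≤ t ≤ u⁻⁴ / 10`. -/
lemma abs_phase_increment_sub_le {u x₀ k t : ℝ} (hu : 1 ≤ u) (hx₀ : 0 ≤ x₀)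
    (hx : 6 * u ^ 6 * x₀ ^ 2 = 1) (hk : 0 ≤ k) (hku : k ≤ u ^ 5) (ht : 0 ≤ t)
    (htu : 10 * u ^ 4 * t ≤ 1) :
    |((u ^ 6 - k) * (x₀ + t) - (u ^ 6 - k) ^ 2 * (x₀ + t) ^ 3
        - ((u ^ 6 - k) * x₀ - (u ^ 6 - k) ^ 2 * x₀ ^ 3))
      - (u ^ 6 * t - u ^ 12 * (3 * x₀ ^ 2 * t + 3 * x₀ * t ^ 2 + t ^ 3))| ≤ 1 / 10 := by
  have hu0 : 0 < u := by linarith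
  obtain ⟨s, rfl⟩ : ∃ s, t = s / u ^ 4 := ⟨t * u ^ 4, by field_simp⟩
  obtain ⟨q, rfl⟩ : ∃ q, k = q * u ^ 5 := ⟨k / u ^ 5, by field_simp⟩
  obtain ⟨y, rfl⟩ : ∃ y, x₀ = y / u ^ 3 := ⟨x₀ * u ^ 3, by field_simp⟩
  obtain ⟨v, rfl⟩ : ∃ v, u = v⁻¹ := ⟨u⁻¹, by simp⟩
  have hv0 : 0 < v := by simpa using hu0
  have hv1 : v ≤ 1 := by
    have := inv_anti₀ one_pos hu
    simpa using this
  have hq0 : 0 ≤ q := nonneg_of_mul_nonneg_left hk (by positivity)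
  have hq1 : q ≤ 1 := by
    by_contra! h
    have : (0:ℝ) < v⁻¹ ^ 5 := by positivity
    nlinarith
  have hs0 : 0 ≤ s := by
    have := mul_nonneg ht (by positivity : 0 ≤ v⁻¹ ^ 4)
    rwa [div_mul_cancel₀ _ (by positivity)] at this
  have hs1 : s ≤ 1 / 10 := by
    have h : 10 * v⁻¹ ^ 4 * (s / v⁻¹ ^ 4) = 10 * s := by field_simp
    linarith
  have hy0 : 0 ≤ y := by
    have := mul_nonneg hx₀ (by positivity : 0 ≤ v⁻¹ ^ 3)
    rwa [div_mul_cancel₀ _ (by positivity)] at this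
  have hy : 6 * y ^ 2 = 1 := by
    rw [← hx]
    field_simp
  have hy1 : y ≤ 1 / 2 := by nlinarith
  have key : ((v⁻¹ ^ 6 - q * v⁻¹ ^ 5) * (y / v⁻¹ ^ 3 + s / v⁻¹ ^ 4)
        - (v⁻¹ ^ 6 - q * v⁻¹ ^ 5) ^ 2 * (y / v⁻¹ ^ 3 + s / v⁻¹ ^ 4) ^ 3
        - ((v⁻¹ ^ 6 - q * v⁻¹ ^ 5) * (y / v⁻¹ ^ 3)
          - (v⁻¹ ^ 6 - q * v⁻¹ ^ 5) ^ 2 * (y / v⁻¹ ^ 3) ^ 3))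
      - (v⁻¹ ^ 6 * (s / v⁻¹ ^ 4) - v⁻¹ ^ 12 * (3 * (y / v⁻¹ ^ 3) ^ 2 * (s / v⁻¹ ^ 4)
          + 3 * (y / v⁻¹ ^ 3) * (s / v⁻¹ ^ 4) ^ 2 + (s / v⁻¹ ^ 4) ^ 3))
      = -(q ^ 2 * s / 2) + q * (2 - q * v) * (3 * y * s ^ 2 + v * s ^ 3) := by
    have h1 : 6 * y ^ 2 * (q * s / v) - q * s / v = 0 := by rw [hy]; ring
    have h2 : q ^ 2 * s / 2 = 6 * y ^ 2 * (q ^ 2 * s / 2) := by rw [hy]; ring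
    rw [h2, ← sub_eq_zero, ← h1]
    field_simp
    ring
  rw [key]
  have hqv : q * v ≤ 1 := mul_le_one₀ hq1 hv0.le hv1
  have hqv0 : 0 ≤ q * v := by positivity
  have hA0 : 0 ≤ q ^ 2 * s / 2 := by positivity
  have hA : q ^ 2 * s / 2 ≤ 1 ^ 2 * (1 / 10) / 2 := by gcongr
  have hB0 : 0 ≤ q * (2 - q * v) * (3 * y * s ^ 2 + v * s ^ 3) :=
    mul_nonneg (mul_nonneg hq0 (by linarith)) (by positivity)
  have hB : q * (2 - q * v) * (3 * y * s ^ 2 + v * s ^ 3)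
      ≤ 1 * 2 * (3 * (1 / 2) * (1 / 10) ^ 2 + 1 * (1 / 10) ^ 3) := by
    gcongr
    · linarith
    · linarith
  rw [abs_le]
  constructor <;> norm_num at hA hB ⊢ <;> linarith

/-- A function bounded below by `C` on a vertical strip of width `τ` inside the square has large
`L²` norm. -/
lemma ofReal_le_eLpNorm_of_strip {f : ℝ × ℝ → ℂ} {x₀ τ C : ℝ} (hx₀ : 0 ≤ x₀) (hτ : 0 ≤ τ)
    (h1 : x₀ + τ ≤ 1) (hC : 0 ≤ C)
    (hf : ∀ p : ℝ × ℝ, x₀ ≤ p.1 → p.1 ≤ x₀ + τ → C ≤ ‖f p‖) :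
    ENNReal.ofReal (C * Real.sqrt (2 * τ)) ≤ eLpNorm f 2 (volume.restrict Sq) := by
  set R : Set (ℝ × ℝ) := Set.Icc x₀ (x₀ + τ) ×ˢ Set.Icc (-1) 1 with hR
  have hRS : R ⊆ Sq :=
    Set.prod_mono (Set.Icc_subset_Icc (by linarith) h1) subset_rfl
  have hRm : MeasurableSet R := measurableSet_Icc.prod measurableSet_Icc
  have hvol : volume R = ENNReal.ofReal (2 * τ) := by
    rw [hR, Measure.volume_eq_prod, Measure.prod_prod, Real.volume_Icc, Real.volume_Icc,
      ← ENNReal.ofReal_mul (by linarith)]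
    ring_nf
  calc ENNReal.ofReal (C * Real.sqrt (2 * τ))
      = eLpNorm (fun _ : ℝ × ℝ => C) 2 (volume.restrict R) := by
        rw [eLpNorm_const' _ (by norm_num) (by norm_num), Measure.restrict_apply_univ, hvol,
          Real.enorm_eq_ofReal hC, ENNReal.ofReal_rpow_of_nonneg (by positivity) (by norm_num),
          ← ENNReal.ofReal_mul hC, Real.sqrt_eq_rpow]
        norm_num
    _ ≤ eLpNorm f 2 (volume.restrict R) := by
        refine eLpNorm_mono_ae ?_
        filter_upwards [ae_restrict_mem hRm] with p hp
        rw [Real.norm_of_nonneg hC]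
        exact hf p hp.1.1 hp.1.2
    _ ≤ eLpNorm f 2 (volume.restrict Sq) :=
        eLpNorm_mono_measure f (Measure.restrict_mono hRS le_rfl)

/-- **Theorem (failure of Theorem 6 for the zero-curvature cylinder `φ(x,y) = −x³`).**
There is `c > 0` such that for every `N ≥ 1` there are coefficients
`(a_{n,m})_{n,m=-N}^N`, not all zero, with
`‖∑ a_{n,m} e(nx + my − (n²+m²)x³)‖_{L²([-1,1]²)} ≥ c N^{1/12} (∑ |a_{n,m}|²)^{1/2}`. -/
theorem stmt12 :
    ∃ c > (0:ℝ), ∀ N : ℕ, 0 < N → ∃ a : ℤ → ℤ → ℂ,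
      (∃ n ∈ Finset.Icc (-(N:ℤ)) (N:ℤ), ∃ m ∈ Finset.Icc (-(N:ℤ)) (N:ℤ), a n m ≠ 0) ∧
      ENNReal.ofReal
          (c * (N:ℝ) ^ ((1:ℝ)/12) *
            Real.sqrt (∑ n ∈ Finset.Icc (-(N:ℤ)) (N:ℤ),
              ∑ m ∈ Finset.Icc (-(N:ℤ)) (N:ℤ), ‖a n m‖^2))
        ≤ eLpNorm (fun p : ℝ × ℝ =>
            ∑ n ∈ Finset.Icc (-(N:ℤ)) (N:ℤ), ∑ m ∈ Finset.Icc (-(N:ℤ)) (N:ℤ),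
              a n m * e ((n:ℝ) * p.1 + (m:ℝ) * p.2 - ((n:ℝ)^2 + (m:ℝ)^2) * p.1^3)) 2
          (volume.restrict Sq) := by
  refine ⟨1 / 5, by norm_num, fun N hN => ?_⟩
  have hN1 : (1:ℝ) ≤ N := by exact_mod_cast hN
  set u : ℝ := (N:ℝ) ^ ((1:ℝ) / 6) with hu_def
  have hu : 1 ≤ u := Real.one_le_rpow hN1 (by norm_num)
  have hu0 : 0 < u := by linarith
  have hu6 : u ^ 6 = N := by
    rw [hu_def, ← Real.rpow_natCast, ← Real.rpow_mul (by positivity)]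
    norm_num
  have hu12 : (N:ℝ) ^ ((1:ℝ) / 12) = Real.sqrt u := by
    rw [Real.sqrt_eq_rpow, hu_def, ← Real.rpow_mul (by positivity)]
    norm_num
  set κ : ℕ := ⌊u ^ 5⌋₊ with hκ
  have hκu : (κ:ℝ) ≤ u ^ 5 := Nat.floor_le (by positivity)
  have huκ : u ^ 5 ≤ κ + 1 := (Nat.lt_floor_add_one _).le
  have hκN : κ ≤ N := by
    have : (κ:ℝ) ≤ N := by
      rw [← hu6]
      exact hκu.trans (pow_le_pow_right₀ hu (by norm_num))
    exact_mod_cast this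
  set x₀ : ℝ := (Real.sqrt (6 * N))⁻¹ with hx₀_def
  have hx₀ : 0 ≤ x₀ := by positivity
  have hx : 6 * u ^ 6 * x₀ ^ 2 = 1 := by
    rw [hu6, hx₀_def, inv_pow, Real.sq_sqrt (by positivity)]
    field_simp
  set J : Finset ℤ := Finset.Icc ((N:ℤ) - κ) N with hJ
  have hJsub : J ⊆ Finset.Icc (-(N:ℤ)) (N:ℤ) := Finset.Icc_subset_Icc (by omega) le_rfl
  have hJcard : (J.card : ℝ) = κ + 1 := by
    have : J.card = κ + 1 := by rw [hJ, Int.card_Icc]; omega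
    exact_mod_cast this
  have h0mem : (0:ℤ) ∈ Finset.Icc (-(N:ℤ)) (N:ℤ) := by simp
  set b : ℤ → ℂ := fun n => e (-((n:ℝ) * x₀ - (n:ℝ) ^ 2 * x₀ ^ 3)) with hb
  refine ⟨fun n m => if m = 0 then (if n ∈ J then b n else 0) else 0,
    ⟨N, by simp, 0, h0mem, ?_⟩, ?_⟩
  · have hNJ : (N:ℤ) ∈ J := by simp [hJ]
    simp only [if_true, hNJ]
    rw [← norm_pos_iff, hb, norm_e]
    exact one_pos
  have hnorm : ∑ n ∈ Finset.Icc (-(N:ℤ)) (N:ℤ), ∑ m ∈ Finset.Icc (-(N:ℤ)) (N:ℤ),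
      ‖(if m = 0 then (if n ∈ J then b n else 0) else 0 : ℂ)‖ ^ 2 = κ + 1 := by
    rw [← hJcard]
    calc _ = ∑ n ∈ Finset.Icc (-(N:ℤ)) (N:ℤ), if n ∈ J then (1:ℝ) else 0 := by
          refine Finset.sum_congr rfl fun n _ => ?_
          rw [Finset.sum_eq_single_of_mem 0 h0mem fun m _ hm => by simp [hm]]
          split_ifs <;> simp_all [norm_e]
      _ = _ := by
          rw [Finset.sum_ite_mem, Finset.inter_eq_right.2 hJsub]
          simp
  have hsum : ∀ p : ℝ × ℝ, ∑ n ∈ Finset.Icc (-(N:ℤ)) (N:ℤ), ∑ m ∈ Finset.Icc (-(N:ℤ)) (N:ℤ),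
      (if m = 0 then (if n ∈ J then b n else 0) else 0 : ℂ)
        * e ((n:ℝ) * p.1 + (m:ℝ) * p.2 - ((n:ℝ)^2 + (m:ℝ)^2) * p.1^3)
      = ∑ n ∈ J, e ((n:ℝ) * p.1 - (n:ℝ) ^ 2 * p.1 ^ 3
          - ((n:ℝ) * x₀ - (n:ℝ) ^ 2 * x₀ ^ 3)) := by
    intro p
    calc _ = ∑ n ∈ Finset.Icc (-(N:ℤ)) (N:ℤ), if n ∈ J then
            e ((n:ℝ) * p.1 - (n:ℝ) ^ 2 * p.1 ^ 3 - ((n:ℝ) * x₀ - (n:ℝ) ^ 2 * x₀ ^ 3)) else 0 := by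
          refine Finset.sum_congr rfl fun n _ => ?_
          rw [Finset.sum_eq_single_of_mem 0 h0mem fun m _ hm => by simp [hm], if_pos rfl]
          split_ifs
          · rw [hb, ← e_add]
            push_cast
            ring_nf
          · simp
      _ = _ := by rw [Finset.sum_ite_mem, Finset.inter_eq_right.2 hJsub]
  have hτ : x₀ + 1 / (10 * u ^ 4) ≤ 1 := by
    have h1 : x₀ ≤ 1 / 2 := by
      have : 1 ≤ u ^ 6 := one_le_pow₀ hu
      nlinarith [sq_nonneg x₀]
    have h2 : 1 / (10 * u ^ 4) ≤ 1 / 10 := by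
      have : 1 ≤ u ^ 4 := one_le_pow₀ hu
      exact one_div_le_one_div_of_le (by norm_num) (by linarith)
    linarith
  refine le_trans (ENNReal.ofReal_le_ofReal ?_)
    (ofReal_le_eLpNorm_of_strip (x₀ := x₀) (τ := 1 / (10 * u ^ 4)) (C := (κ + 1) / 2) hx₀
      (by positivity) hτ (by positivity) fun p hp1 hp2 => ?_)
  · rw [hnorm, hu12]
    have hL : 1 / 5 * Real.sqrt u * Real.sqrt (κ + 1) = Real.sqrt (1 / 25 * u * (κ + 1)) := by
      rw [Real.sqrt_mul (by positivity), Real.sqrt_mul (by positivity)]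
      congr 2
      rw [show (1 / 25 : ℝ) = (1 / 5) ^ 2 by norm_num, Real.sqrt_sq (by norm_num)]
    rw [hL]
    refine Real.sqrt_le_iff.2 ⟨by positivity, ?_⟩
    rw [mul_pow, Real.sq_sqrt (by positivity)]
    calc 1 / 25 * u * (κ + 1) = u ^ 5 * (κ + 1) / (25 * u ^ 4) := by field_simp
      _ ≤ (κ + 1) * (κ + 1) / (20 * u ^ 4) := by
          gcongr
          norm_num
      _ = _ := by field_simp; norm_num
  · rw [hsum p, ← hJcard]
    set t : ℝ := p.1 - x₀ with ht
    have hp : p.1 = x₀ + t := by rw [ht]; ring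
    refine card_div_two_le_norm_sum_e J _
      (u ^ 6 * t - u ^ 12 * (3 * x₀ ^ 2 * t + 3 * x₀ * t ^ 2 + t ^ 3)) fun n hn => ?_
    rw [hJ, Finset.mem_Icc] at hn
    have hn1 : (N:ℝ) - κ ≤ n := by exact_mod_cast hn.1
    have hn2 : (n:ℝ) ≤ N := by exact_mod_cast hn.2
    have htu : 10 * u ^ 4 * t ≤ 1 := by
      have : t ≤ 1 / (10 * u ^ 4) := by linarith
      rw [le_div_iff₀ (by positivity)] at this
      linarith
    have := abs_phase_increment_sub_le (k := u ^ 6 - n) hu hx₀ hx (by linarith) (by linarith)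
      (by linarith : 0 ≤ t) htu
    rwa [sub_sub_cancel, ← hp] at this
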